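/- arXiv:2107.14214 — 5 statements merged into one kernel-verified Lean document; each statement's English description precedes it below -/
import Mathlib

section
/- (Lemma 3.1) Let n be a positive integer and k an integer with 1 ≤ k ≤ n. Let i, j be integers with 1 ≤ j ≤ i ≤ n−1 and j + k ≤ n. Then the cardinality of (B_i ∩ B_j) \ B₀ equals 0 if i − j ≥ k, and equals j + k − max(k, i) otherwise. -/
/-- The interval `B_i = {i, i+1, …, i+k-1}` viewed inside `ZMod n`. -/
def cyclicInterval (n : ℕ) (k i : ℤ) : Set (ZMod n) :=
  (fun t : ℤ => (t : ZMod n)) '' Set.Ico i (i + k)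

theorem cast_cases_aux (n : ℕ) (a b : ℤ) (h : (a : ZMod n) = (b : ZMod n))
    (h1 : b - a < 2 * n) (h2 : a - b < 2 * n) : a = b ∨ a = b + n ∨ b = a + n := by
  rw [ZMod.intCast_eq_intCast_iff_dvd_sub] at h
  obtain ⟨c, hc⟩ := h
  have hc1 : c < 2 := by
    by_contra hcc
    nlinarith
  have hc2 : -2 < c := by
    by_contra hcc
    nlinarith
  have : c = -1 ∨ c = 0 ∨ c = 1 := by omega
  rcases this with rfl | rfl | rfl <;> omega

/-- (Lemma 3.1) For `1 ≤ j ≤ i ≤ n-1` with `j + k ≤ n`, the cardinality of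
`(B_i ∩ B_j) \ B₀` is `0` if `i - j ≥ k`, and `j + k - max k i` otherwise. -/
theorem card_inter_diff_cyclicInterval (n : ℕ) (hn : 0 < n) (k : ℤ) (hk : 1 ≤ k)
    (hkn : k ≤ n) (i j : ℤ) (hj : 1 ≤ j) (hji : j ≤ i) (hi : i ≤ (n : ℤ) - 1)
    (hjk : j + k ≤ n) :
    (((cyclicInterval n k i ∩ cyclicInterval n k j) \ cyclicInterval n k 0).ncard : ℤ) =
      if k ≤ i - j then 0 else j + k - max k i := by
  have key : (cyclicInterval n k i ∩ cyclicInterval n k j) \ cyclicInterval n k 0 =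
      (fun t : ℤ => (t : ZMod n)) '' Set.Ico (max k i) (j + k) := by
    ext x
    constructor
    · rintro ⟨⟨⟨a, ⟨ha1, ha2⟩, rfl⟩, ⟨b, ⟨hb1, hb2⟩, hab⟩⟩, h0⟩
      have hbk : k ≤ b := by
        by_contra hlt
        exact h0 ⟨b, ⟨by omega, by omega⟩, hab⟩
      refine ⟨b, ⟨?_, hb2⟩, hab⟩
      rcases cast_cases_aux n b a hab (by omega) (by omega) with h | h | h <;> omega
    · rintro ⟨b, ⟨hb1, hb2⟩, rfl⟩
      refine ⟨⟨⟨b, ⟨by omega, by omega⟩, rfl⟩, ⟨b, ⟨by omega, by omega⟩, rfl⟩⟩, ?_⟩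
      rintro ⟨a, ⟨ha1, ha2⟩, hab⟩
      rcases cast_cases_aux n a b hab (by omega) (by omega) with h | h | h <;> omega
  rw [key, Set.InjOn.ncard_image]
  · rw [← Finset.coe_Ico, Set.ncard_coe_finset, Int.card_Ico]
    split_ifs <;> omega
  · rintro a ⟨ha1, ha2⟩ b ⟨hb1, hb2⟩ hab
    rcases cast_cases_aux n a b hab (by omega) (by omega) with h | h | h <;> omega
end

section
/- (Lemma 3.2) Let n be a positive integer, k an integer with 1 ≤ k ≤ n, and let Q be a nonempty subset of B₀ = {0, 1, …, k−1}. Let q₁ and q₂ be respectively the smallest and largest integers in {0, …, k−1} whose residues lie in Q. Then for every integer t with 0 ≤ t ≤ n−1, the shifted interval B_t is disjoint from Q if and only if t = q₁ + i for some integer i with q₂ − q₁ < i ≤ n − k. In particular, there are exactly max(n − k − q₂ + q₁, 0) such shifts t in {0, …, n−1}. -/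
/-- (Lemma 3.2) Let `Q` be a nonempty subset of `B₀ = {0,…,k-1}` and let `q₁, q₂` be the
smallest and largest integers in `{0,…,k-1}` whose residues lie in `Q`.  Then for
`0 ≤ t ≤ n-1`, the interval `B_t` is disjoint from `Q` iff `t = q₁ + i` for some
`q₂ - q₁ < i ≤ n - k`; in particular there are exactly `max (n - k - q₂ + q₁) 0` such `t`. -/
theorem disjoint_shift_iff (n : ℕ) (hn : 0 < n) (k : ℤ) (hk : 1 ≤ k) (hkn : k ≤ n)
    (Q : Set (ZMod n)) (hQsub : Q ⊆ cyclicInterval n k 0) (hQne : Q.Nonempty)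
    (q₁ q₂ : ℤ)
    (hq₁mem : q₁ ∈ Set.Ico 0 k) (hq₁Q : (q₁ : ZMod n) ∈ Q)
    (hq₁min : ∀ t ∈ Set.Ico 0 k, ((t : ZMod n) ∈ Q) → q₁ ≤ t)
    (hq₂mem : q₂ ∈ Set.Ico 0 k) (hq₂Q : (q₂ : ZMod n) ∈ Q)
    (hq₂max : ∀ t ∈ Set.Ico 0 k, ((t : ZMod n) ∈ Q) → t ≤ q₂) :
    (∀ t : ℤ, 0 ≤ t → t ≤ (n : ℤ) - 1 →
      (Disjoint (cyclicInterval n k t) Q ↔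
        ∃ i : ℤ, q₂ - q₁ < i ∧ i ≤ (n : ℤ) - k ∧ t = q₁ + i)) ∧
    (({t : ℤ | 0 ≤ t ∧ t ≤ (n : ℤ) - 1 ∧ Disjoint (cyclicInterval n k t) Q}.ncard : ℤ) =
      max ((n : ℤ) - k - q₂ + q₁) 0) := by
  obtain ⟨h10, h1k⟩ := hq₁mem
  obtain ⟨h20, h2k⟩ := hq₂mem
  have key : ∀ t : ℤ, 0 ≤ t → t ≤ (n : ℤ) - 1 →
      (Disjoint (cyclicInterval n k t) Q ↔ q₂ < t ∧ t ≤ q₁ + n - k) := by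
    intro t ht0 htn
    rw [Set.disjoint_left]
    constructor
    · intro h
      constructor
      · by_contra hc
        exact h ⟨q₂, ⟨by omega, by omega⟩, rfl⟩ hq₂Q
      · by_contra hc
        exact h ⟨q₁ + n, ⟨by omega, by omega⟩, by simp⟩ hq₁Q
    · rintro ⟨ha, hb⟩ x ⟨s, ⟨hs1, hs2⟩, hsx⟩ hxQ
      obtain ⟨r, hr, hrx⟩ := hQsub hxQ
      simp only at hsx hrx
      rw [zero_add] at hr
      have h1 := hq₁min r hr (hrx ▸ hxQ)
      have h2 := hq₂max r hr (hrx ▸ hxQ)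
      have hd : (r : ZMod n) = (s : ZMod n) := hrx.trans hsx.symm
      rw [ZMod.intCast_eq_intCast_iff_dvd_sub] at hd
      have := Int.le_of_dvd (by omega) hd
      omega
  constructor
  · intro t ht0 htn
    rw [key t ht0 htn]
    constructor
    · rintro ⟨ha, hb⟩
      exact ⟨t - q₁, by omega, by omega, by omega⟩
    · rintro ⟨i, ha, hb, rfl⟩
      constructor <;> omega
  · have hS : {t : ℤ | 0 ≤ t ∧ t ≤ (n : ℤ) - 1 ∧ Disjoint (cyclicInterval n k t) Q} =
        (Finset.Ioc q₂ (q₁ + n - k) : Finset ℤ) := by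
      ext t
      simp only [Set.mem_setOf_eq, Finset.coe_Ioc, Set.mem_Ioc]
      constructor
      · rintro ⟨a, b, c⟩
        exact (key t a b).1 c
      · rintro ⟨a, b⟩
        have h0 : 0 ≤ t := by omega
        have h1 : t ≤ (n : ℤ) - 1 := by omega
        exact ⟨h0, h1, (key t h0 h1).2 ⟨a, b⟩⟩
    rw [hS, Set.ncard_coe_finset, Int.card_Ioc]
    omega
end

section
/- (Proposition 4.4) Let n be a positive integer and A ⊆ ℤ_n, and let ℓ = |{a ∈ A : a − 1 ∉ A}| be the number of maximal blocks of cyclically consecutive elements of A. Then the cardinality of Stab(A) divides ℓ. -/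
/-- The stabilizer `Stab(A) = {s : ℤ_n | A + s = A}` as an additive subgroup of `ℤ_n`. -/
def stab (n : ℕ) (A : Set (ZMod n)) : AddSubgroup (ZMod n) where
  carrier := {s | (fun a => a + s) '' A = A}
  zero_mem' := by simp
  add_mem' := by
    intro a b ha hb
    simp only [Set.mem_setOf_eq] at *
    rw [show (fun x : ZMod n => x + (a + b)) = (fun x => x + b) ∘ (fun x => x + a) by
      funext x; simp [add_assoc], Set.image_comp, ha, hb]
  neg_mem' := by
    intro a ha
    simp only [Set.mem_setOf_eq] at *
    conv_lhs => rw [← ha, ← Set.image_comp]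
    simp


/-- (Proposition 4.4) The cardinality of `Stab(A)` divides the number
`ℓ = |{a ∈ A : a - 1 ∉ A}|` of maximal blocks of cyclically consecutive elements of `A`. -/
theorem card_stab_dvd_blocks (n : ℕ) (hn : 0 < n) (A : Set (ZMod n)) :
    Nat.card (stab n A) ∣ {a ∈ A | a - 1 ∉ A}.ncard := by
  have hmem : ∀ s ∈ stab n A, ∀ a, a + s ∈ A ↔ a ∈ A := by
    intro s hs a
    have hs' : (fun a => a + s) '' A = A := hs
    constructor
    · intro h
      rw [← hs'] at h
      obtain ⟨b, hb, hba⟩ := h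
      have : b = a := add_right_cancel hba
      exact this ▸ hb
    · intro h
      rw [← hs']
      exact ⟨a, h, rfl⟩
  have key : {a ∈ A | a - 1 ∉ A} = (QuotientAddGroup.mk : ZMod n → ZMod n ⧸ stab n A) ⁻¹'
      ((QuotientAddGroup.mk : ZMod n → ZMod n ⧸ stab n A) '' {a ∈ A | a - 1 ∉ A}) := by
    apply Set.Subset.antisymm (Set.subset_preimage_image _ _)
    rintro x ⟨y, ⟨hy, hy1⟩, hyx⟩
    have hs := QuotientAddGroup.eq.mp hyx
    have h1 := hmem _ hs y
    have h2 := hmem _ hs (y - 1)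
    rw [show y + (-y + x) = x by abel] at h1
    rw [show y - 1 + (-y + x) = x - 1 by abel] at h2
    exact ⟨h1.mpr hy, fun h => hy1 (h2.mp h)⟩
  rw [key, ← Nat.card_coe_set_eq,
    Nat.card_congr (QuotientAddGroup.preimageMkEquivAddSubgroupProdSet _ _), Nat.card_prod]
  exact dvd_mul_right _ _
end

section
/- (Corollary 4.5) Let n be a positive integer and k an integer with 1 ≤ k < n. Let Q ⊆ B₀ = {0,…,k−1} and P ⊆ ℤ_n \ B₀ with |P| = |Q|, and set A = (B₀ \ Q) ∪ P. Then the cardinality of Stab(A) is at most 2|Q| + 1. -/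
/-- The interval `B₀ = {0, 1, …, k-1}` viewed inside `ZMod n`. -/
def B₀ (n k : ℕ) : Set (ZMod n) := (fun t : ℕ => (t : ZMod n)) '' Set.Iio k

theorem aux_gen (n : ℕ) (H : AddSubgroup (ZMod n)) :
    ∃ m : ℕ, ∀ z : ℤ, (z : ZMod n) ∈ H ↔ (m : ℤ) ∣ z := by
  obtain ⟨a, ha⟩ := Int.subgroup_cyclic (H.comap (Int.castAddHom (ZMod n)))
  refine ⟨a.natAbs, fun z => ?_⟩
  have : (z : ZMod n) ∈ H ↔ z ∈ H.comap (Int.castAddHom (ZMod n)) := by simp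
  rw [this, ha, Int.natAbs_dvd, ← AddSubgroup.zmultiples_eq_closure, Int.mem_zmultiples_iff]

theorem aux_card (n k : ℕ) (hkn : k < n) (H : AddSubgroup (ZMod n)) (m : ℕ)
    (hm : ∀ z : ℤ, (z : ZMod n) ∈ H ↔ (m : ℤ) ∣ z) (x : ℕ) :
    ({z | z - (x : ZMod n) ∈ H} ∩ B₀ n k).ncard = Nat.count (· ≡ x [MOD m]) k := by
  classical
  have h1 : {z | z - (x : ZMod n) ∈ H} ∩ B₀ n k =
      (fun t : ℕ => (t : ZMod n)) '' ((Finset.range k).filter (· ≡ x [MOD m]) : Finset ℕ) := by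
    have key : ∀ t : ℕ, (t : ZMod n) - x ∈ H ↔ t ≡ x [MOD m] := by
      intro t
      have := hm ((t : ℤ) - x)
      push_cast at this
      rw [this, Nat.ModEq.comm, Nat.modEq_iff_dvd]
    ext z
    simp only [B₀, Set.mem_inter_iff, Set.mem_ofPred_eq, Set.mem_image, Set.mem_Iio,
      Finset.coe_filter, Finset.mem_range]
    constructor
    · rintro ⟨h, t, ht, rfl⟩
      exact ⟨t, ⟨ht, (key t).1 h⟩, rfl⟩
    · rintro ⟨t, ⟨ht, h⟩, rfl⟩
      exact ⟨(key t).2 h, t, ht, rfl⟩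
  rw [h1, Set.InjOn.ncard_image, Set.ncard_coe_finset, Nat.count_eq_card_filter_range]
  intro a ha b hb hab
  simp only [Finset.coe_filter, Finset.mem_range, Set.mem_ofPred_eq] at ha hb
  have := (ZMod.natCast_eq_natCast_iff' a b n).1 hab
  rwa [Nat.mod_eq_of_lt (by omega), Nat.mod_eq_of_lt (by omega)] at this

theorem aux_B (n k : ℕ) (hkn : k < n) : (B₀ n k).ncard = k := by
  have := aux_card n k hkn ⊤ 1 (by simp) 0
  simpa [Nat.modEq_one, Nat.count_true] using this

theorem aux_coset (n : ℕ) (H : AddSubgroup (ZMod n)) (x : ZMod n) :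
    {z | z - x ∈ H}.ncard = Nat.card H := by
  have : {z | z - x ∈ H} = (fun z => z + x) '' (H : Set (ZMod n)) := by
    ext z
    simp [sub_eq_add_neg]
  rw [this, Set.ncard_image_of_injective _ (add_left_injective x)]
  rfl

/-- (Corollary 4.5) If `A = (B₀ \ Q) ∪ P` with `Q ⊆ B₀`, `P ⊆ ℤ_n \ B₀` and `|P| = |Q|`,
then `|Stab(A)| ≤ 2|Q| + 1`. -/
theorem card_stab_le (n k : ℕ) (hn : 0 < n) (hk : 1 ≤ k) (hkn : k < n)
    (Q P : Set (ZMod n)) (hQ : Q ⊆ B₀ n k) (hP : P ⊆ (B₀ n k)ᶜ)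
    (hPQ : P.ncard = Q.ncard) :
    Nat.card (stab n ((B₀ n k \ Q) ∪ P)) ≤ 2 * Q.ncard + 1 := by
  haveI : NeZero n := ⟨hn.ne'⟩
  set A := (B₀ n k \ Q) ∪ P with hA
  set H := stab n A with hH
  have hAcard : A.ncard = k := by
    rw [hA, Set.ncard_union_eq (Set.disjoint_left.2 fun z hz hz' => hP hz' hz.1)
      (Set.toFinite _) (Set.toFinite _), hPQ, Set.ncard_diff_add_ncard_of_subset hQ, aux_B n k hkn]
  have hst : ∀ s ∈ H, ∀ z ∈ A, z + s ∈ A := by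
    intro s hs z hz
    have hs' : (fun a => a + s) '' A = A := hs
    rw [← hs']
    exact ⟨z, hz, rfl⟩
  obtain ⟨x, hx⟩ : A.Nonempty := by
    rw [← Set.ncard_pos]; omega
  obtain ⟨y, hy⟩ : ∃ y, y ∉ A := by
    by_contra! h
    have : A = Set.univ := Set.eq_univ_of_forall h
    rw [this, Set.ncard_univ, Nat.card_zmod] at hAcard
    omega
  obtain ⟨m, hm⟩ := aux_gen n H
  have hmpos : 0 < m := by
    have := (hm n).1 (by simp)
    have := Int.natCast_dvd_natCast.1 this
    exact Nat.pos_of_dvd_of_pos this hn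
  have cx := aux_card n k hkn H m hm x.val
  have cy := aux_card n k hkn H m hm y.val
  rw [ZMod.natCast_zmod_val, Nat.count_modEq_card _ hmpos] at cx cy
  have hC := aux_coset n H x
  have h1 : ({z | z - x ∈ H} \ B₀ n k).ncard ≤ P.ncard := by
    apply Set.ncard_le_ncard _ (Set.toFinite _)
    rintro z ⟨hz, hzB⟩
    have := hst _ hz x hx
    rw [add_sub_cancel] at this
    rcases this with h | h
    · exact absurd h.1 hzB
    · exact h
  have h2 : ({z | z - y ∈ H} ∩ B₀ n k).ncard ≤ Q.ncard := by
    apply Set.ncard_le_ncard _ (Set.toFinite _)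
    rintro z ⟨hz, hzB⟩
    by_contra hzQ
    have := hst _ (H.neg_mem hz) z (Or.inl ⟨hzB, hzQ⟩)
    rw [neg_sub, add_sub_cancel] at this
    exact hy this
  have h3 := Set.ncard_inter_add_ncard_diff_eq_ncard {z | z - x ∈ H} (B₀ n k) (Set.toFinite _)
  split_ifs at cx cy <;> omega
end

section
/- (Proposition 6.9) Let F be a field, n a positive integer, k a natural number, and let G : Fin k → (ZMod n → F) be a matrix whose rows span a cyclic code: assume that for every c in the F-linear span of the rows of G, the cyclically shifted vector i ↦ c(i − 1) also lies in this span. Then for every subset S ⊆ ZMod n and every s ∈ ZMod n, the family of columns of G indexed by S, i.e. the family (fun i => G i j) for j ∈ S (as vectors in Fin k → F), is linearly independent over F if and only if the family of columns indexed by the translate S + s = {j + s : j ∈ S} is linearly independent over F. Hence the matroid on ℤ_n whose independent sets are the sets of indices of linearly independent columns of G is a cyclic matroid. -/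
theorem shift_map_aux (F : Type*) [Field F] (n : ℕ) (hn : 0 < n)
    (k : ℕ) (G : Fin k → (ZMod n → F))
    (hcyc : ∀ c ∈ Submodule.span F (Set.range G),
      (fun i => c (i - 1)) ∈ Submodule.span F (Set.range G)) (t : ZMod n) :
    ∃ L : (Fin k → F) →ₗ[F] (Fin k → F), ∀ j : ZMod n,
      L (fun i => G i j) = fun i => G i (j - t) := by
  haveI : NeZero n := ⟨hn.ne'⟩
  have key : ∀ m : ℕ, ∀ c ∈ Submodule.span F (Set.range G),
      (fun i => c (i - (m : ZMod n))) ∈ Submodule.span F (Set.range G) := by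
    intro m
    induction m with
    | zero => intro c hc; simpa using hc
    | succ m ih =>
      intro c hc
      have h := hcyc _ (ih c hc)
      have e : (fun i => c (i - ((m + 1 : ℕ) : ZMod n))) =
          (fun i => c (i - 1 - (m : ZMod n))) := by
        funext i
        congr 1
        push_cast
        ring
      rw [e]
      exact h
  have h : ∀ i, ∃ a : Fin k → F, ∑ l, a l • G l = fun j => G i (j - t) := by
    intro i
    have h := key t.val (G i) (Submodule.subset_span ⟨i, rfl⟩)
    rw [ZMod.natCast_zmod_val] at h
    exact (Submodule.mem_span_range_iff_exists_fun F).1 h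
  choose A hA using h
  refine ⟨Matrix.mulVecLin (Matrix.of A), fun j => ?_⟩
  funext i
  have h := congrFun (hA i) j
  simpa [Matrix.mulVec, dotProduct, Finset.sum_apply] using h

/-- (Proposition 6.9) Let `G : Fin k → (ZMod n → F)` be a generator matrix of a cyclic
code, i.e. the `F`-span of its rows is closed under the cyclic shift `c ↦ (i ↦ c (i-1))`.
Then for every `S ⊆ ZMod n` and every shift `s`, the columns of `G` indexed by `S` are
linearly independent iff the columns indexed by the translate `S + s` are linearly
independent.  Hence the column matroid of `G` is a cyclic matroid. -/
theorem cyclic_code_column_matroid_cyclic (F : Type*) [Field F] (n : ℕ) (hn : 0 < n)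
    (k : ℕ) (G : Fin k → (ZMod n → F))
    (hcyc : ∀ c ∈ Submodule.span F (Set.range G),
      (fun i => c (i - 1)) ∈ Submodule.span F (Set.range G)) :
    ∀ (S : Set (ZMod n)) (s : ZMod n),
      (LinearIndependent F (fun j : S => fun i : Fin k => G i (j : ZMod n)) ↔
        LinearIndependent F
          (fun j : ((fun x => x + s) '' S) => fun i : Fin k => G i (j : ZMod n))) := by
  intro S s
  obtain ⟨L, hL⟩ := shift_map_aux F n hn k G hcyc s
  obtain ⟨M, hM⟩ := shift_map_aux F n hn k G hcyc (-s)
  have hinj : Function.Injective (fun x : ZMod n => x + s) := add_left_injective s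
  rw [← linearIndependent_equiv (Equiv.Set.image (fun x : ZMod n => x + s) S hinj)]
  constructor
  · intro h
    refine LinearIndependent.of_comp L ?_
    convert h using 1
    funext j
    simp [hL]
  · intro h
    refine LinearIndependent.of_comp M ?_
    convert h using 1
    funext j
    simp [hM]
end
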